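/- arXiv:1508.03664 — 2 statements merged into one kernel-verified Lean document; each statement's English description precedes it below -/
import Mathlib

section
/- (Proposition 1, feedback-aided transmission.) The feedback-aided intercept probability is a nondecreasing function of the number of transmitted coded packets: for all erasure probabilities ε_B, ε_E ∈ [0,1] and all integers K ≤ N₁ ≤ N₂, P^FT_int(N₁) ≤ P^FT_int(N₂). -/
open Finset

/-- Decoding probability P(n_R, K) = ∏_{i=0}^{K−1} (1 − q^{−(n_R − i)}). -/
noncomputable def Pdec (q K nR : ℕ) : ℝ :=
  ∏ i ∈ Finset.range K, (1 - (q : ℝ) ^ (-((nR : ℤ) - (i : ℤ))))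

/-- CDF F_ε(n_T) = ∑_{n_R=K}^{n_T} C(n_T,n_R) (1−ε)^{n_R} ε^{n_T−n_R} P(n_R,K). -/
noncomputable def Fcdf (q K : ℕ) (ε : ℝ) (nT : ℕ) : ℝ :=
  ∑ nR ∈ Finset.Icc K nT,
    (nT.choose nR : ℝ) * (1 - ε) ^ nR * ε ^ (nT - nR) * Pdec q K nR

/-- PMF f_ε(n_T) = F_ε(n_T) − F_ε(n_T−1) for n_T > K, and f_ε(K) = F_ε(K). -/
noncomputable def fpmf (q K : ℕ) (ε : ℝ) (nT : ℕ) : ℝ :=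
  if nT = K then Fcdf q K ε K else Fcdf q K ε nT - Fcdf q K ε (nT - 1)

/-- Intercept probability of feedback-aided transmission. -/
noncomputable def PFT (q K : ℕ) (εB εE : ℝ) (N : ℕ) : ℝ :=
  (∑ nT ∈ Finset.Icc K N, fpmf q K εB nT * Fcdf q K εE nT)
    + Fcdf q K εE N * (1 - Fcdf q K εB N)

/-- Intercept probability of unaided transmission. -/
noncomputable def PUT (q K : ℕ) (εE : ℝ) (N : ℕ) : ℝ := Fcdf q K εE N

theorem one_sub_zpow_neg_mem_Icc {q : ℕ} (hq : 1 ≤ q) {z : ℤ} (hz : 0 ≤ z) :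
    1 - (q : ℝ) ^ (-z) ∈ Set.Icc (0 : ℝ) 1 := by
  have h1 : (1 : ℝ) ≤ q := by exact_mod_cast hq
  have h2 : (q : ℝ) ^ (-z) ≤ 1 := zpow_le_one_of_nonpos₀ h1 (by omega)
  have h3 : (0 : ℝ) ≤ (q : ℝ) ^ (-z) := by positivity
  exact ⟨by linarith, by linarith⟩

theorem Pdec_eq_zero_of_lt (q : ℕ) {K m : ℕ} (h : m < K) : Pdec q K m = 0 :=
  Finset.prod_eq_zero (Finset.mem_range.mpr h) (by simp)

theorem Pdec_mem_Icc {q : ℕ} (hq : 1 ≤ q) (K m : ℕ) : Pdec q K m ∈ Set.Icc (0 : ℝ) 1 := by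
  rcases lt_or_ge m K with h | h
  · simp [Pdec_eq_zero_of_lt q h]
  · have hfac : ∀ i ∈ Finset.range K,
        1 - (q : ℝ) ^ (-((m : ℤ) - (i : ℤ))) ∈ Set.Icc (0 : ℝ) 1 := fun i hi =>
      one_sub_zpow_neg_mem_Icc hq (by have := Finset.mem_range.mp hi; omega)
    exact ⟨Finset.prod_nonneg fun i hi => (hfac i hi).1,
      Finset.prod_le_one (fun i hi => (hfac i hi).1) fun i hi => (hfac i hi).2⟩

theorem Pdec_monotone {q : ℕ} (hq : 1 ≤ q) (K : ℕ) : Monotone (Pdec q K) := by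
  refine monotone_nat_of_le_succ fun m => ?_
  rcases lt_or_ge m K with h | h
  · rw [Pdec_eq_zero_of_lt q h]
    exact (Pdec_mem_Icc hq K _).1
  · have h1 : (1 : ℝ) ≤ q := by exact_mod_cast hq
    refine Finset.prod_le_prod (fun i hi => (one_sub_zpow_neg_mem_Icc hq ?_).1) fun i _ =>
      sub_le_sub_left (zpow_le_zpow_right₀ h1 ?_) 1
    · have := Finset.mem_range.mp hi
      omega
    · push_cast
      omega

theorem Fcdf_eq_sum_range (q K : ℕ) (ε : ℝ) (n : ℕ) :
    Fcdf q K ε n = ∑ m ∈ Finset.range (n + 1),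
      (n.choose m : ℝ) * ((1 - ε) ^ m * ε ^ (n - m) * Pdec q K m) := by
  unfold Fcdf
  simp only [← mul_assoc]
  refine Finset.sum_subset (fun m hm => ?_) fun m hm hm' => ?_
  · simp only [Finset.mem_Icc, Finset.mem_range] at hm ⊢
    omega
  · simp only [Finset.mem_Icc, Finset.mem_range] at hm hm'
    rw [Pdec_eq_zero_of_lt q (by omega), mul_zero]

theorem Fcdf_le_one {q : ℕ} (hq : 1 ≤ q) (K : ℕ) {ε : ℝ} (hε : ε ∈ Set.Icc (0 : ℝ) 1) (n : ℕ) :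
    Fcdf q K ε n ≤ 1 := by
  have h0 := hε.1
  have h1 : 0 ≤ 1 - ε := sub_nonneg.mpr hε.2
  calc
    Fcdf q K ε n ≤ ∑ m ∈ Finset.range (n + 1), (1 - ε) ^ m * ε ^ (n - m) * (n.choose m : ℝ) := by
      rw [Fcdf_eq_sum_range]
      refine Finset.sum_le_sum fun m _ => ?_
      rw [mul_comm]
      exact mul_le_mul_of_nonneg_right
        (mul_le_of_le_one_right (by positivity) (Pdec_mem_Icc hq K m).2) (by positivity)
    _ = 1 := by rw [← add_pow, sub_add_cancel, one_pow]

theorem Fcdf_monotone {q : ℕ} (hq : 1 ≤ q) (K : ℕ) {ε : ℝ} (hε : ε ∈ Set.Icc (0 : ℝ) 1) :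
    Monotone (Fcdf q K ε) := by
  have h0 := hε.1
  have h1 : 0 ≤ 1 - ε := sub_nonneg.mpr hε.2
  refine monotone_nat_of_le_succ fun n => ?_
  rw [Fcdf_eq_sum_range, Fcdf_eq_sum_range,
    Finset.sum_choose_succ_mul fun m k => (1 - ε) ^ m * ε ^ k * Pdec q K m,
    ← Finset.sum_add_distrib]
  refine Finset.sum_le_sum fun m hm => ?_
  rw [← mul_add]
  refine mul_le_mul_of_nonneg_left ?_ (by positivity)
  rw [Nat.sub_add_comm (Nat.lt_succ_iff.mp (Finset.mem_range.mp hm))]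
  have hstep : 0 ≤ (1 - ε) ^ m * ε ^ (n - m) * ((1 - ε) * (Pdec q K (m + 1) - Pdec q K m)) :=
    mul_nonneg (by positivity)
      (mul_nonneg h1 (sub_nonneg.mpr (Pdec_monotone hq K (Nat.le_succ m))))
  linear_combination hstep

theorem PFT_succ_sub (q : ℕ) {K N : ℕ} (εB εE : ℝ) (hN : K ≤ N) :
    PFT q K εB εE (N + 1) - PFT q K εB εE N =
      (Fcdf q K εE (N + 1) - Fcdf q K εE N) * (1 - Fcdf q K εB N) := by
  have hf : fpmf q K εB (N + 1) = Fcdf q K εB (N + 1) - Fcdf q K εB N := by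
    rw [fpmf, if_neg (by omega), Nat.add_sub_cancel]
  unfold PFT
  rw [Finset.sum_Icc_succ_top (by omega), hf]
  ring

theorem ft_intercept_monotone (q K : ℕ) (hq : 2 ≤ q) (hK : 1 ≤ K)
    (εB εE : ℝ) (hεB : εB ∈ Set.Icc (0:ℝ) 1) (hεE : εE ∈ Set.Icc (0:ℝ) 1)
    (N₁ N₂ : ℕ) (hN₁ : K ≤ N₁) (h12 : N₁ ≤ N₂) :
    PFT q K εB εE N₁ ≤ PFT q K εB εE N₂ := by
  have hq1 : 1 ≤ q := by omega
  induction N₂, h12 using Nat.le_induction with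
  | base => exact le_rfl
  | succ N hN ih =>
    refine ih.trans (sub_nonneg.mp ?_)
    rw [PFT_succ_sub q εB εE (hN₁.trans hN)]
    exact mul_nonneg (sub_nonneg.mpr (Fcdf_monotone hq1 K hεE N.le_succ))
      (sub_nonneg.mpr (Fcdf_le_one hq1 K hεB N))
end

section
/- Feedback never increases the eavesdropper's interception capability: for all erasure probabilities ε_B, ε_E ∈ [0,1] and every integer N ≥ K, P^FT_int(N) ≤ P^UT_int(N), i.e., ∑_{n_T=K}^{N} f_B(n_T) F_E(n_T) + F_E(N)(1 − F_B(N)) ≤ F_E(N). -/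
open Finset

theorem Pdec_eq_zero {q K nR : ℕ} (h : nR < K) : Pdec q K nR = 0 :=
  Finset.prod_eq_zero (Finset.mem_range.mpr h) (by simp)

theorem Pdec_factor_nonneg {q nR i : ℕ} (hq : 2 ≤ q) (h : i ≤ nR) :
    0 ≤ 1 - (q : ℝ) ^ (-((nR : ℤ) - (i : ℤ))) := by
  have hq1 : (1 : ℝ) ≤ q := by exact_mod_cast (by omega : 1 ≤ q)
  exact sub_nonneg.mpr (zpow_le_one_of_nonpos₀ hq1 (by omega))

theorem Pdec_nonneg {q : ℕ} (hq : 2 ≤ q) (K nR : ℕ) : 0 ≤ Pdec q K nR := by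
  rcases lt_or_ge nR K with h | h
  · exact (Pdec_eq_zero h).ge
  · refine Finset.prod_nonneg fun i hi => Pdec_factor_nonneg hq ?_
    have := Finset.mem_range.mp hi
    omega

theorem Pdec_le_succ {q : ℕ} (hq : 2 ≤ q) (K nR : ℕ) : Pdec q K nR ≤ Pdec q K (nR + 1) := by
  rcases lt_or_ge nR K with h | h
  · exact (Pdec_eq_zero h).trans_le (Pdec_nonneg hq K _)
  · have hq1 : (1 : ℝ) ≤ q := by exact_mod_cast (by omega : 1 ≤ q)
    refine Finset.prod_le_prod (fun i hi => Pdec_factor_nonneg hq ?_) fun i _ => ?_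
    · have := Finset.mem_range.mp hi
      omega
    · exact sub_le_sub_left (zpow_le_zpow_right₀ hq1 (by push_cast; omega)) 1

theorem Fcdf_nonneg {q : ℕ} (hq : 2 ≤ q) (K : ℕ) {ε : ℝ} (hε : ε ∈ Set.Icc (0 : ℝ) 1)
    (n : ℕ) : 0 ≤ Fcdf q K ε n := by
  have h0 := hε.1
  have h1 : 0 ≤ 1 - ε := sub_nonneg.mpr hε.2
  refine Finset.sum_nonneg fun r _ => ?_
  have := Pdec_nonneg hq K r
  positivity

/-- Since `Pdec q K` vanishes below `K`, the CDF is a full binomial sum. -/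
theorem Fcdf_eq_sum_antidiagonal (q K : ℕ) (ε : ℝ) (n : ℕ) :
    Fcdf q K ε n = ∑ ij ∈ Finset.HasAntidiagonal.antidiagonal n,
      (n.choose ij.1 : ℝ) * ((1 - ε) ^ ij.1 * ε ^ ij.2 * Pdec q K ij.1) := by
  rw [Finset.Nat.sum_antidiagonal_eq_sum_range_succ
    (fun i j => (n.choose i : ℝ) * ((1 - ε) ^ i * ε ^ j * Pdec q K i)), Fcdf]
  refine (Finset.sum_congr rfl fun r _ => by ring).trans
    (Finset.sum_subset (fun r hr => ?_) fun r hr hr' => ?_)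
  · have := Finset.mem_Icc.mp hr
    exact Finset.mem_range.mpr (by omega)
  · rw [Finset.mem_range] at hr
    rw [Finset.mem_Icc] at hr'
    rw [Pdec_eq_zero (by omega : r < K)]
    simp

theorem Fcdf_le_succ {q : ℕ} (hq : 2 ≤ q) (K : ℕ) {ε : ℝ} (hε : ε ∈ Set.Icc (0 : ℝ) 1)
    (n : ℕ) : Fcdf q K ε n ≤ Fcdf q K ε (n + 1) := by
  have h0 := hε.1
  have h1 : 0 ≤ 1 - ε := sub_nonneg.mpr hε.2
  rw [Fcdf_eq_sum_antidiagonal, Fcdf_eq_sum_antidiagonal,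
    Finset.sum_antidiagonal_choose_succ_mul
      (fun i j => (1 - ε) ^ i * ε ^ j * Pdec q K i), ← Finset.sum_add_distrib]
  refine Finset.sum_le_sum fun ij hij => ?_
  rw [← Nat.choose_symm_of_eq_add (Finset.HasAntidiagonal.mem_antidiagonal.mp hij).symm]
  have hc : 0 ≤ (n.choose ij.1 : ℝ) * (1 - ε) ^ ij.1 * ε ^ ij.2 * (1 - ε) := by positivity
  linear_combination mul_le_mul_of_nonneg_left (Pdec_le_succ hq K ij.1) hc

theorem PFT_self (q K : ℕ) (εB εE : ℝ) : PFT q K εB εE K = PUT q K εE K := by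
  simp only [PFT, PUT, Finset.Icc_self, Finset.sum_singleton, fpmf, if_true]
  ring

theorem PFT_succ {q K : ℕ} (εB εE : ℝ) {n : ℕ} (hn : K ≤ n) :
    PFT q K εB εE (n + 1) =
      PFT q K εB εE n + (Fcdf q K εE (n + 1) - Fcdf q K εE n) * (1 - Fcdf q K εB n) := by
  have hf : fpmf q K εB (n + 1) = Fcdf q K εB (n + 1) - Fcdf q K εB n := by
    rw [fpmf, if_neg (by omega), Nat.add_sub_cancel]
  rw [PFT, PFT, Finset.sum_Icc_succ_top (by omega), hf]
  ring

theorem ft_le_ut (q K : ℕ) (hq : 2 ≤ q) (hK : 1 ≤ K)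
    (εB εE : ℝ) (hεB : εB ∈ Set.Icc (0:ℝ) 1) (hεE : εE ∈ Set.Icc (0:ℝ) 1)
    (N : ℕ) (hN : K ≤ N) :
    PFT q K εB εE N ≤ PUT q K εE N := by
  induction N, hN using Nat.le_induction with
  | base => exact (PFT_self q K εB εE).le
  | succ n hn ih =>
    rw [PFT_succ εB εE hn]
    unfold PUT at ih ⊢
    have := mul_nonneg (sub_nonneg.mpr (Fcdf_le_succ hq K hεE n)) (Fcdf_nonneg hq K hεB n)
    linarith
end
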